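/- Suppose dim R = d ≥ 1. If M is a Λ-lattice, then Ext^i_{Λ^op}(Tr M, Λ) = 0 for all 1 ≤ i ≤ d, where Tr M is the Auslander transpose of M: the cokernel of Hom_Λ(P_0, Λ) → Hom_Λ(P_1, Λ) for a minimal projective presentation P_1 → P_0 → M → 0 of M. -/

import Mathlib

universe u

open IsLocalRing

noncomputable section

namespace BT

/-- The length of a module, defined as the Krull dimension of its lattice of
submodules (which agrees with the usual composition-series length). -/
def moduleLength (A : Type u) [Ring A] (M : Type u) [AddCommGroup M] [Module A M] :
    WithBot ℕ∞ :=
  Order.krullDim (Submodule A M)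

/-- `M` is a maximal Cohen-Macaulay module over the local ring `R`: it admits an
`M`-regular sequence contained in the maximal ideal whose length is `dim R`
(i.e. `depth_R M = dim R`). -/
def IsMCM (R : Type u) [CommRing R] [IsLocalRing R]
    (M : Type u) [AddCommGroup M] [Module R M] : Prop :=
  ∃ rs : List R, (∀ r ∈ rs, r ∈ maximalIdeal R) ∧ RingTheory.Sequence.IsRegular M rs ∧
    (rs.length : WithBot ℕ∞) = ringKrullDim R

/-- The `n`-th Ext group of two `R`-modules. -/
def extGroup (R : Type u) [CommRing R] (n : ℕ)
    (A B : Type u) [AddCommGroup A] [Module R A] [AddCommGroup B] [Module R B] : Type u :=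
  ((Ext R (ModuleCat.{u} R) n).obj (Opposite.op (ModuleCat.of R A))).obj (ModuleCat.of R B)

instance (R : Type u) [CommRing R] (n : ℕ)
    (A B : Type u) [AddCommGroup A] [Module R A] [AddCommGroup B] [Module R B] :
    AddCommGroup (extGroup R n A B) :=
  inferInstanceAs (AddCommGroup
    (((Ext R (ModuleCat.{u} R) n).obj (Opposite.op (ModuleCat.of R A))).obj (ModuleCat.of R B)))

instance (R : Type u) [CommRing R] (n : ℕ)
    (A B : Type u) [AddCommGroup A] [Module R A] [AddCommGroup B] [Module R B] :
    Module R (extGroup R n A B) :=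
  inferInstanceAs (Module R
    (((Ext R (ModuleCat.{u} R) n).obj (Opposite.op (ModuleCat.of R A))).obj (ModuleCat.of R B)))

/-- `ω` is a canonical module for the Cohen-Macaulay local ring `R`: it is a
finitely generated module with `Ext^i_R(k, ω) = 0` for `i ≠ dim R` and
`Ext^{dim R}_R(k, ω) ≅ k`. -/
def IsCanonicalModule (R : Type u) [CommRing R] [IsLocalRing R]
    (ω : Type u) [AddCommGroup ω] [Module R ω] : Prop :=
  Module.Finite R ω ∧ ∃ d : ℕ, (d : WithBot ℕ∞) = ringKrullDim R ∧
    (∀ i : ℕ, i ≠ d → Subsingleton (extGroup R i (ResidueField R) ω)) ∧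
    Nonempty (extGroup R d (ResidueField R) ω ≃ₗ[R] ResidueField R)

/-- A homomorphism of `Λ`-modules factors through a projective `Λ`-module. -/
def FactorsThroughProjective (Λ : Type u) [Ring Λ] {M N : Type u}
    [AddCommGroup M] [Module Λ M] [AddCommGroup N] [Module Λ N] (f : M →ₗ[Λ] N) : Prop :=
  ∃ (P : Type u) (_ : AddCommGroup P) (_ : Module Λ P), Module.Projective Λ P ∧
    ∃ (g : M →ₗ[Λ] P) (h : P →ₗ[Λ] N), h.comp g = f

section StableHom

variable (R : Type u) [CommRing R] (Λ : Type u) [Ring Λ] [Algebra R Λ]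
variable (M N : Type u) [AddCommGroup M] [Module Λ M]
  [AddCommGroup N] [Module Λ N] [Module R N] [IsScalarTower R Λ N]

/-- The `R`-submodule of `Hom_Λ(M, N)` consisting of the homomorphisms that
factor through a projective `Λ`-module. -/
def projTrivial : Submodule R (M →ₗ[Λ] N) where
  carrier := {f | FactorsThroughProjective Λ f}
  zero_mem' := ⟨Λ, inferInstance, inferInstance, inferInstance, 0, 0, by ext; simp⟩
  add_mem' := by
    rintro f₁ f₂ ⟨P₁, _, _, hP₁, g₁, h₁, rfl⟩ ⟨P₂, _, _, hP₂, g₂, h₂, rfl⟩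
    exact ⟨P₁ × P₂, inferInstance, inferInstance, inferInstance,
      g₁.prod g₂, h₁.comp (LinearMap.fst Λ P₁ P₂) + h₂.comp (LinearMap.snd Λ P₁ P₂),
      by ext m; simp⟩
  smul_mem' := by
    rintro r f ⟨P, _, _, hP, g, h, rfl⟩
    exact ⟨P, inferInstance, inferInstance, hP, g, r • h, by ext m; simp⟩

/-- The stable Hom `Hom-bar_Λ(M, N)`: homomorphisms modulo those factoring
through projectives, as an `R`-module. -/
def stableHom : Type u := (M →ₗ[Λ] N) ⧸ projTrivial R Λ M N

instance : AddCommGroup (stableHom R Λ M N) :=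
  inferInstanceAs (AddCommGroup ((M →ₗ[Λ] N) ⧸ projTrivial R Λ M N))

instance : Module R (stableHom R Λ M N) :=
  inferInstanceAs (Module R ((M →ₗ[Λ] N) ⧸ projTrivial R Λ M N))

end StableHom

/-- The `h`-length of `M` (relative to a fixed module `G`): the length over `R`
of `h(M) = Hom-bar_Λ(M, M ⊕ G)`. -/
def hLength (R : Type u) [CommRing R] (Λ : Type u) [Ring Λ] [Algebra R Λ]
    (M : Type u) [AddCommGroup M] [Module Λ M] [Module R M] [IsScalarTower R Λ M]
    (G : Type u) [AddCommGroup G] [Module Λ G] [Module R G] [IsScalarTower R Λ G] :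
    WithBot ℕ∞ :=
  moduleLength R (stableHom R Λ M (M × G))

/-- A module is indecomposable if it is nonzero and admits no nontrivial direct
sum decomposition. -/
def IsIndecomposable (Λ : Type u) [Ring Λ] (M : Type u) [AddCommGroup M] [Module Λ M] : Prop :=
  Nontrivial M ∧ ∀ A B : Submodule Λ M, IsCompl A B → A = ⊥ ∨ B = ⊥

/-- `Ext¹_Λ(M, Y) = 0`, expressed by the splitting of extensions: every
surjection onto `M` with kernel isomorphic to `Y` splits. -/
def Ext1Vanishes (Λ : Type u) [Ring Λ] (M Y : Type u)
    [AddCommGroup M] [Module Λ M] [AddCommGroup Y] [Module Λ Y] : Prop :=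
  ∀ (E : Type u) (_ : AddCommGroup E) (_ : Module Λ E) (g : E →ₗ[Λ] M),
    Function.Surjective g → Nonempty ((LinearMap.ker g) ≃ₗ[Λ] Y) →
      ∃ s : M →ₗ[Λ] E, g.comp s = LinearMap.id

/-- A homomorphism `f : X → C` is right minimal if every endomorphism `g` of `X`
with `f ∘ g = f` is an isomorphism. -/
def RightMinimal (Λ : Type u) [Ring Λ] {X C : Type u} [AddCommGroup X] [Module Λ X]
    [AddCommGroup C] [Module Λ C] (f : X →ₗ[Λ] C) : Prop :=
  ∀ g : X →ₗ[Λ] X, f.comp g = f → Function.Bijective g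

/-- Multiplication by `s ∈ R` on `M` lifts along `g : E → M`. -/
def SmulLiftsAlong (R : Type u) [CommRing R] (Λ : Type u) [Ring Λ] [Algebra R Λ]
    {E M : Type u} [AddCommGroup E] [Module Λ E] [AddCommGroup M] [Module Λ M]
    (s : R) (g : E →ₗ[Λ] M) : Prop :=
  ∃ h : M →ₗ[Λ] E, ∀ m, g (h m) = algebraMap R Λ s • m

/-- The localization `M_p` of the finitely generated `Λ`-module `M` is a
projective `Λ_p`-module.  (For a finitely generated module over a noetherian
algebra this is equivalent to the following lifting property: for every
surjection of `Λ`-modules onto `M`, multiplication by some `s ∉ p` lifts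
along it.) -/
def LocallyProjectiveAt (R : Type u) [CommRing R] (Λ : Type u) [Ring Λ] [Algebra R Λ]
    (p : Ideal R) (M : Type u) [AddCommGroup M] [Module Λ M] : Prop :=
  ∀ (E : Type u) (_ : AddCommGroup E) (_ : Module Λ E) (g : E →ₗ[Λ] M),
    Function.Surjective g → ∃ s ∉ p, SmulLiftsAlong R Λ s g

/-- The action of `a : Λ` on a `Λ`-module `M`, as an `R`-linear map. -/
def actionMap (R : Type u) [CommRing R] (Λ : Type u) [Ring Λ] [Algebra R Λ]
    (M : Type u) [AddCommGroup M] [Module Λ M] [Module R M] [IsScalarTower R Λ M]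
    (a : Λ) : M →ₗ[R] M where
  toFun m := a • m
  map_add' := smul_add a
  map_smul' r m := smul_comm a r m

/-- For a left `Λ`-module `M`, the module `Hom_R(M, ω)` is a right `Λ`-module,
i.e. a left `Λᵐᵒᵖ`-module, via `(aᵒᵖ • f) m = f (a • m)`. -/
instance omegaDualModule (R : Type u) [CommRing R] (Λ : Type u) [Ring Λ] [Algebra R Λ]
    (ω : Type u) [AddCommGroup ω] [Module R ω]
    (M : Type u) [AddCommGroup M] [Module Λ M] [Module R M] [IsScalarTower R Λ M] :
    Module Λᵐᵒᵖ (M →ₗ[R] ω) where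
  smul a f := f.comp (actionMap R Λ M a.unop)
  one_smul f := LinearMap.ext fun m => congrArg f (one_smul Λ m)
  mul_smul a b f := LinearMap.ext fun m => congrArg f (mul_smul b.unop a.unop m)
  smul_zero _ := LinearMap.ext fun _ => rfl
  smul_add _ _ _ := LinearMap.ext fun _ => rfl
  add_smul a b f := LinearMap.ext fun m => by
    show f ((a.unop + b.unop) • m) = f (a.unop • m) + f (b.unop • m)
    rw [add_smul, map_add]
  zero_smul f := LinearMap.ext fun m => by
    show f ((0 : Λ) • m) = 0
    rw [zero_smul, map_zero]

/-- `M` is a `Λ`-lattice: it is finitely generated, maximal Cohen-Macaulay as an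
`R`-module, `M_p` is `Λ_p`-projective for every non-maximal prime `p`, and
`Hom_R(M, ω)_p` is `Λ_p^op`-projective for every non-maximal prime `p`. -/
def IsLattice (R : Type u) [CommRing R] [IsLocalRing R]
    (Λ : Type u) [Ring Λ] [Algebra R Λ]
    (ω : Type u) [AddCommGroup ω] [Module R ω]
    (M : Type u) [AddCommGroup M] [Module Λ M] [Module R M] [IsScalarTower R Λ M] : Prop :=
  Module.Finite Λ M ∧ IsMCM R M ∧
    (∀ p : Ideal R, p.IsPrime → p ≠ maximalIdeal R → LocallyProjectiveAt R Λ p M) ∧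
    (∀ p : Ideal R, p.IsPrime → p ≠ maximalIdeal R →
      LocallyProjectiveAt R Λᵐᵒᵖ p (M →ₗ[R] ω))

/-- `Y` is a lat-injective module: it is a lattice and `Ext¹_Λ(M, Y) = 0` for
every `Λ`-lattice `M`. -/
def IsLatInjective (R : Type u) [CommRing R] [IsLocalRing R]
    (Λ : Type u) [Ring Λ] [Algebra R Λ]
    (ω : Type u) [AddCommGroup ω] [Module R ω]
    (Y : Type u) [AddCommGroup Y] [Module Λ Y] [Module R Y] [IsScalarTower R Λ Y] : Prop :=
  IsLattice R Λ ω Y ∧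
    ∀ (M : Type u) (_ : AddCommGroup M) (_ : Module Λ M) (_ : Module R M)
      (_ : IsScalarTower R Λ M), IsLattice R Λ ω M → Ext1Vanishes Λ M Y

/-- `Y` admits a finite resolution `0 → L_t → ⋯ → L_0 → Y → 0` by lat-injective
modules. -/
def HasLatInjResOfLength (R : Type u) [CommRing R] [IsLocalRing R]
    (Λ : Type u) [Ring Λ] [Algebra R Λ]
    (ω : Type u) [AddCommGroup ω] [Module R ω] :
    ℕ → ∀ (Y : Type u) [AddCommGroup Y] [Module Λ Y] [Module R Y] [IsScalarTower R Λ Y], Prop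
  | 0, Y, _, _, _, _ => IsLatInjective R Λ ω Y
  | (t + 1), Y, _, _, _, _ =>
      ∃ (L : Type u) (_ : AddCommGroup L) (_ : Module Λ L) (_ : Module R L)
        (_ : IsScalarTower R Λ L) (π : L →ₗ[Λ] Y), IsLatInjective R Λ ω L ∧
          Function.Surjective π ∧ HasLatInjResOfLength R Λ ω t (LinearMap.ker π)

/-- `α : X → C` is a minimal lat-approximation of the `Λ`-module `C`: `X` is a
lattice, `α` is surjective and right minimal, and its kernel admits a finite
resolution by lat-injectives. -/
def IsMinimalLatApprox (R : Type u) [CommRing R] [IsLocalRing R]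
    (Λ : Type u) [Ring Λ] [Algebra R Λ] (ω : Type u) [AddCommGroup ω] [Module R ω]
    {X : Type u} [AddCommGroup X] [Module Λ X] [Module R X] [IsScalarTower R Λ X]
    {C : Type u} [AddCommGroup C] [Module Λ C] (α : X →ₗ[Λ] C) : Prop :=
  IsLattice R Λ ω X ∧ Function.Surjective α ∧
    (∃ t : ℕ, HasLatInjResOfLength R Λ ω t (LinearMap.ker α)) ∧ RightMinimal Λ α

/-- `Sfam` is a complete set of pairwise non-isomorphic simple `Λ`-modules, and
`α : G → S` is a minimal lat-approximation of their direct sum `S = ⨁ i, Sfam i`. -/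
def IsSimplesApprox (R : Type u) [CommRing R] [IsLocalRing R]
    (Λ : Type u) [Ring Λ] [Algebra R Λ] (ω : Type u) [AddCommGroup ω] [Module R ω]
    (ι : Type u) [Fintype ι] (Sfam : ι → Type u) [∀ i, AddCommGroup (Sfam i)]
    [∀ i, Module Λ (Sfam i)]
    (G : Type u) [AddCommGroup G] [Module Λ G] [Module R G] [IsScalarTower R Λ G]
    (α : G →ₗ[Λ] ∀ i, Sfam i) : Prop :=
  (∀ i, IsSimpleModule Λ (Sfam i)) ∧
  (∀ i j, i ≠ j → IsEmpty (Sfam i ≃ₗ[Λ] Sfam j)) ∧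
  (∀ (T : Type u) (_ : AddCommGroup T) (_ : Module Λ T),
      IsSimpleModule Λ T → ∃ i, Nonempty (T ≃ₗ[Λ] Sfam i)) ∧
  IsMinimalLatApprox R Λ ω α

/-- There are infinitely many pairwise non-isomorphic indecomposable
`Λ`-lattices of `h`-length `t`. -/
def InfManyIndecLatticesOfHLength (R : Type u) [CommRing R] [IsLocalRing R]
    (Λ : Type u) [Ring Λ] [Algebra R Λ] (ω : Type u) [AddCommGroup ω] [Module R ω]
    (G : Type u) [AddCommGroup G] [Module Λ G] [Module R G] [IsScalarTower R Λ G]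
    (t : ℕ) : Prop :=
  ∃ (F : ℕ → Type u) (_ : ∀ n, AddCommGroup (F n)) (_ : ∀ n, Module Λ (F n))
    (_ : ∀ n, Module R (F n)) (_ : ∀ n, IsScalarTower R Λ (F n)),
    (∀ n, IsLattice R Λ ω (F n) ∧ IsIndecomposable Λ (F n) ∧
      hLength R Λ (F n) G = (t : WithBot ℕ∞)) ∧
    ∀ m n : ℕ, m ≠ n → IsEmpty (F m ≃ₗ[Λ] F n)

/-- `Λ` has strongly unbounded lattice type: there is an infinite strictly
increasing sequence `b 0 < b 1 < ⋯` of integers such that for each `i` there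
are infinitely many pairwise non-isomorphic indecomposable `Λ`-lattices of
`h`-length `b i`. -/
def StronglyUnboundedLatType (R : Type u) [CommRing R] [IsLocalRing R]
    (Λ : Type u) [Ring Λ] [Algebra R Λ] (ω : Type u) [AddCommGroup ω] [Module R ω]
    (G : Type u) [AddCommGroup G] [Module Λ G] [Module R G] [IsScalarTower R Λ G] : Prop :=
  ∃ b : ℕ → ℕ, StrictMono b ∧ ∀ i, InfManyIndecLatticesOfHLength R Λ ω G (b i)

/-- `Λ` is of finite lattice type: there are only finitely many isomorphism
classes of indecomposable `Λ`-lattices. -/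
def FiniteLatType (R : Type u) [CommRing R] [IsLocalRing R]
    (Λ : Type u) [Ring Λ] [Algebra R Λ] (ω : Type u) [AddCommGroup ω] [Module R ω] : Prop :=
  ∃ (n : ℕ) (F : Fin n → Type u) (_ : ∀ i, AddCommGroup (F i)) (_ : ∀ i, Module Λ (F i)),
    ∀ (M : Type u) (_ : AddCommGroup M) (_ : Module Λ M) (_ : Module R M)
      (_ : IsScalarTower R Λ M), IsLattice R Λ ω M → IsIndecomposable Λ M →
        ∃ i, Nonempty (M ≃ₗ[Λ] F i)

/-- `N` is an `i`-th syzygy module of `C` over the ring `Γ`: a kernel in a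
projective resolution of `C`. -/
def IsSyzygyOf (Γ : Type u) [Ring Γ] :
    ℕ → ∀ (N : Type u) [AddCommGroup N] [Module Γ N]
      (C : Type u) [AddCommGroup C] [Module Γ C], Prop
  | 0, N, _, _, C, _, _ => Nonempty (N ≃ₗ[Γ] C)
  | (i + 1), N, _, _, C, _, _ =>
      ∃ (K : Type u) (_ : AddCommGroup K) (_ : Module Γ K), IsSyzygyOf Γ i K C ∧
        ∃ (P : Type u) (_ : AddCommGroup P) (_ : Module Γ P), Module.Projective Γ P ∧
          ∃ π : P →ₗ[Γ] K, Function.Surjective π ∧ Nonempty (N ≃ₗ[Γ] LinearMap.ker π)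

/-- Precomposition with `δ : P₁ → P₀` on the `Λ`-duals `Hom_Λ(-, Λ)`, which are
right `Λ`-modules, i.e. `Λᵐᵒᵖ`-modules. -/
def transposeDual (Λ : Type u) [Ring Λ] {P₁ P₀ : Type u}
    [AddCommGroup P₁] [Module Λ P₁] [AddCommGroup P₀] [Module Λ P₀]
    (δ : P₁ →ₗ[Λ] P₀) : (P₀ →ₗ[Λ] Λ) →ₗ[Λᵐᵒᵖ] (P₁ →ₗ[Λ] Λ) where
  toFun f := f.comp δ
  map_add' f g := LinearMap.ext fun _ => rfl
  map_smul' a f := LinearMap.ext fun _ => rfl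

section ExtLemmas

open CategoryTheory Abelian

variable {A : Type u} [Ring A]
variable {L : Type u} [AddCommGroup L] [Module A L]
variable {Q : Type u} [AddCommGroup Q] [Module A Q]
variable {K : Type u} [AddCommGroup K] [Module A K]
variable {Y : Type u} [AddCommGroup Y] [Module A Y]

/-- The short complex of module categories given by an exact pair of linear maps. -/
abbrev exactPair (f : L →ₗ[A] Q) (g : Q →ₗ[A] K) (hfg : Function.Exact f g) :
    ShortComplex (ModuleCat.{u} A) :=
  ModuleCat.shortComplexOfCompEqZero f g hfg.linearMap_comp_eq_zero

lemma exactPair_shortExact {f : L →ₗ[A] Q} {g : Q →ₗ[A] K} (hf : Function.Injective f)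
    (hfg : Function.Exact f g) (hg : Function.Surjective g) : (exactPair f g hfg).ShortExact :=
  ModuleCat.shortComplex_shortExact _ hfg hf hg

lemma subsingleton_ext_one_of_extends [Module.Projective A Q]
    {f : L →ₗ[A] Q} {g : Q →ₗ[A] K} (hf : Function.Injective f)
    (hfg : Function.Exact f g) (hg : Function.Surjective g)
    (hext : ∀ φ : L →ₗ[A] Y, ∃ ψ : Q →ₗ[A] Y, ψ.comp f = φ) :
    Subsingleton (Ext (ModuleCat.of A K) (ModuleCat.of A Y) 1) := by
  have hS := exactPair_shortExact hf hfg hg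
  have : Projective (exactPair f g hfg).X₂ :=
    (IsProjective.iff_projective (R := A) Q).mp inferInstance
  refine subsingleton_of_forall_eq 0 fun x => ?_
  obtain ⟨y, rfl⟩ := precomp_extClass_surjective_of_projective_X₂ (ModuleCat.of A Y) hS 0 x
  obtain ⟨φ, rfl⟩ := (Ext.mk₀_bijective _ _).2 y
  obtain ⟨ψ, hψ⟩ := hext φ.hom
  have hφ : φ = (exactPair f g hfg).f ≫ ModuleCat.ofHom ψ := by
    ext x
    exact (LinearMap.congr_fun hψ x).symm
  have := hS.extClass_comp_assoc (γ := Ext.mk₀ (ModuleCat.ofHom ψ)) (h := rfl)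
  rw [Ext.mk₀_comp_mk₀, ← hφ] at this
  exact this

lemma subsingleton_ext_succ_of_kernel [Module.Projective A Q]
    {f : L →ₗ[A] Q} {g : Q →ₗ[A] K} (hf : Function.Injective f)
    (hfg : Function.Exact f g) (hg : Function.Surjective g) (n : ℕ)
    (h : Subsingleton (Ext (ModuleCat.of A L) (ModuleCat.of A Y) n)) :
    Subsingleton (Ext (ModuleCat.of A K) (ModuleCat.of A Y) (n + 1)) := by
  have hS := exactPair_shortExact hf hfg hg
  have : Projective (exactPair f g hfg).X₂ :=
    (IsProjective.iff_projective (R := A) Q).mp inferInstance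
  exact (precomp_extClass_surjective_of_projective_X₂ (ModuleCat.of A Y) hS n).subsingleton

lemma subsingleton_ext_kernel [Module.Projective A Q]
    {f : L →ₗ[A] Q} {g : Q →ₗ[A] K} (hf : Function.Injective f)
    (hfg : Function.Exact f g) (hg : Function.Surjective g) (n : ℕ)
    (h : Subsingleton (Ext (ModuleCat.of A K) (ModuleCat.of A Y) (n + 2))) :
    Subsingleton (Ext (ModuleCat.of A L) (ModuleCat.of A Y) (n + 1)) := by
  have hS := exactPair_shortExact hf hfg hg
  have : Projective (exactPair f g hfg).X₂ :=
    (IsProjective.iff_projective (R := A) Q).mp inferInstance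
  refine subsingleton_of_forall_eq 0 fun x => ?_
  obtain ⟨y, rfl⟩ := Ext.contravariant_sequence_exact₁ hS _ x (by omega : 1 + (n + 1) = n + 2)
    (Subsingleton.elim (h := h) _ _)
  rw [Ext.eq_zero_of_projective y, Ext.comp_zero]

lemma subsingleton_ext_of_isSyzygyOf {n : ℕ} :
    ∀ {N C : Type u} [AddCommGroup N] [Module A N] [AddCommGroup C] [Module A C],
      IsSyzygyOf A n N C → ∀ m : ℕ,
        Subsingleton (Ext (ModuleCat.of A C) (ModuleCat.of A Y) (n + m + 1)) →
        Subsingleton (Ext (ModuleCat.of A N) (ModuleCat.of A Y) (m + 1)) := by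
  induction n with
  | zero =>
    intro N C _ _ _ _ hN m h
    obtain ⟨e⟩ := hN
    rw [zero_add] at h
    refine subsingleton_of_forall_eq 0 fun x => ?_
    have hx : (Ext.mk₀ (ModuleCat.ofHom e.toLinearMap)).comp
        ((Ext.mk₀ (ModuleCat.ofHom e.symm.toLinearMap)).comp x (zero_add _)) (zero_add _) = x := by
      rw [← Ext.comp_assoc_of_second_deg_zero, Ext.mk₀_comp_mk₀, ← ModuleCat.ofHom_comp,
        LinearEquiv.symm_comp]
      exact Ext.mk₀_id_comp x
    rw [← hx, Subsingleton.elim (h := h) ((Ext.mk₀ _).comp x (zero_add _)) 0, Ext.comp_zero]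
  | succ n ih =>
    intro N C _ _ _ _ hN m h
    obtain ⟨K, _, _, hK, P, _, _, hP, π, hπ, ⟨e⟩⟩ := hN
    refine subsingleton_ext_kernel (f := (LinearMap.ker π).subtype.comp e.toLinearMap) (g := π)
      ((LinearMap.ker π).subtype_injective.comp e.injective) ?_ hπ m (ih hK (m + 1) ?_)
    · rw [LinearMap.exact_iff, LinearMap.range_comp, LinearEquiv.range, Submodule.map_top,
        Submodule.range_subtype]
    · rwa [show n + (m + 1) + 1 = n + 1 + m + 1 by omega]

lemma ext1Vanishes_of_subsingleton_ext
    (h : Subsingleton (Ext (ModuleCat.of A K) (ModuleCat.of A Y) 1)) : Ext1Vanishes A K Y := by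
  intro E _ _ g hg ⟨e⟩
  have hfg : Function.Exact ((LinearMap.ker g).subtype.comp e.symm.toLinearMap) g := by
    rw [LinearMap.exact_iff, LinearMap.range_comp, LinearEquiv.range, Submodule.map_top,
      Submodule.range_subtype]
  have hS := exactPair_shortExact (f := (LinearMap.ker g).subtype.comp e.symm.toLinearMap)
    ((LinearMap.ker g).subtype_injective.comp e.symm.injective) hfg hg
  obtain ⟨x, hx⟩ := Ext.covariant_sequence_exact₃ (ModuleCat.of A K) hS
    (Ext.mk₀ (𝟙 (ModuleCat.of A K))) (zero_add 1) (Subsingleton.elim (h := h) _ _)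
  obtain ⟨s, rfl⟩ := (Ext.mk₀_bijective _ _).2 x
  rw [Ext.mk₀_comp_mk₀] at hx
  have hs := (Ext.mk₀_bijective _ _).1 hx
  refine ⟨s.hom, LinearMap.ext fun k => ?_⟩
  exact LinearMap.congr_fun (congrArg ModuleCat.Hom.hom hs) k

end ExtLemmas

section Depth

open CategoryTheory Abelian

variable (R : Type u) [CommRing R] [IsLocalRing R]

/-- The homological form of `depth X ≥ n`: `Ext^i_R(k, X) = 0` for all `i < n`. -/
def DepthGE (n : ℕ) (X : Type u) [AddCommGroup X] [Module R X] : Prop :=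
  ∀ i < n, Subsingleton (Ext (ModuleCat.of R (ResidueField R)) (ModuleCat.of R X) i)

variable {R}
variable {X : Type u} [AddCommGroup X] [Module R X]
variable {Y : Type u} [AddCommGroup Y] [Module R Y]
variable {Z : Type u} [AddCommGroup Z] [Module R Z]

lemma DepthGE.mono {m n : ℕ} (h : DepthGE R n X) (hmn : m ≤ n) : DepthGE R m X :=
  fun i hi => h i (hi.trans_le hmn)

lemma IsMCM.depthGE [IsNoetherianRing R] [Module.Finite R X] {d : ℕ}
    (hdim : ringKrullDim R = (d : WithBot ℕ∞)) (h : IsMCM R X) : DepthGE R d X := by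
  obtain ⟨rs, hmem, hreg, hlen⟩ := h
  have hd : rs.length = d := by
    rw [hdim] at hlen
    exact_mod_cast hlen
  have : Nontrivial X := hreg.nontrivial
  rw [← hd]
  refine ModuleCat.subsingleton_ext_of_exists_isRegular (maximalIdeal R)
    (ModuleCat.of R (ResidueField R)) ?_ (ModuleCat.of R X) ?_ rs hmem hreg
  · change Module.support R (R ⧸ maximalIdeal R) ⊆ _
    rw [Module.support_eq_zeroLocus, Ideal.annihilator_quotient]
  · exact (Submodule.top_ne_ideal_smul_of_le_jacobson_annihilator
      (IsLocalRing.maximalIdeal_le_jacobson _)).symm.lt_top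

lemma DepthGE.of_leftInverse {n : ℕ} (h : DepthGE R n Y) (f : X →ₗ[R] Y) (g : Y →ₗ[R] X)
    (hgf : g.comp f = LinearMap.id) : DepthGE R n X := by
  intro i hi
  have := h i hi
  refine subsingleton_of_forall_eq 0 fun x => ?_
  have hx : (x.comp (Ext.mk₀ (ModuleCat.ofHom f)) (add_zero i)).comp
      (Ext.mk₀ (ModuleCat.ofHom g)) (add_zero i) = x := by
    rw [Ext.comp_assoc_of_third_deg_zero, Ext.mk₀_comp_mk₀, ← ModuleCat.ofHom_comp, hgf]
    exact Ext.comp_mk₀_id x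
  rw [← hx, Subsingleton.elim (x.comp (Ext.mk₀ (ModuleCat.ofHom f)) (add_zero i)) 0,
    Ext.zero_comp]

lemma DepthGE.pi {n : ℕ} (h : DepthGE R n X) (ι : Type) [Fintype ι] [DecidableEq ι] :
    DepthGE R n (ι → X) := by
  intro i hi
  have := h i hi
  refine subsingleton_of_forall_eq 0 fun x => ?_
  have hid : 𝟙 (ModuleCat.of R (ι → X)) = ∑ j : ι,
      ModuleCat.ofHom (LinearMap.proj j) ≫ ModuleCat.ofHom (LinearMap.single R (fun _ => X) j) := by
    ext v
    simp [ModuleCat.hom_sum]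
  rw [← Ext.comp_mk₀_id x, hid, Ext.mk₀_sum, Ext.comp_sum]
  refine Finset.sum_eq_zero fun j _ => ?_
  rw [← Ext.mk₀_comp_mk₀, ← Ext.comp_assoc_of_third_deg_zero,
    Subsingleton.elim (x.comp (Ext.mk₀ (ModuleCat.ofHom (LinearMap.proj j))) (add_zero i)) 0,
    Ext.zero_comp]

lemma DepthGE.cokernel {n : ℕ} {f : X →ₗ[R] Y} {g : Y →ₗ[R] Z} (hf : Function.Injective f)
    (hfg : Function.Exact f g) (hg : Function.Surjective g)
    (hX : DepthGE R (n + 1) X) (hY : DepthGE R n Y) : DepthGE R n Z := by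
  intro i hi
  have hS := exactPair_shortExact hf hfg hg
  have h₁ := hX (i + 1) (by omega)
  have h₂ := hY i hi
  refine subsingleton_of_forall_eq 0 fun x => ?_
  obtain ⟨y, rfl⟩ := Ext.covariant_sequence_exact₃ _ hS x rfl (Subsingleton.elim (h := h₁) _ _)
  rw [Subsingleton.elim (h := h₂) y 0, Ext.zero_comp]

lemma depthGE_one_iff :
    DepthGE R 1 X ↔ ∀ x : X, (∀ s ∈ maximalIdeal R, s • x = 0) → x = 0 := by
  have key : DepthGE R 1 X ↔ Subsingleton (ResidueField R →ₗ[R] X) := by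
    rw [← (Ext.addEquiv₀.trans ModuleCat.homAddEquiv :
      Ext (ModuleCat.of R (ResidueField R)) (ModuleCat.of R X) 0 ≃+ _).subsingleton_congr]
    exact ⟨fun h => h 0 one_pos, fun h i hi => by rwa [Nat.lt_one_iff.mp hi]⟩
  rw [key]
  constructor
  · intro h x hx
    let f : (R ⧸ maximalIdeal R) →ₗ[R] X :=
      (maximalIdeal R).liftQ (LinearMap.toSpanSingleton R X x) fun s hs => by
        simpa using hx s hs
    have hf : f = 0 := h.elim f 0
    have h1 : f (Submodule.Quotient.mk 1) = 0 := by rw [hf, LinearMap.zero_apply]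
    exact (one_smul R x).symm.trans h1
  · intro h
    refine subsingleton_of_forall_eq 0 fun f => ?_
    have h1 : f 1 = 0 := h _ fun s hs => by
      rw [← map_smul, Algebra.smul_def, mul_one, ResidueField.algebraMap_eq,
        (residue_eq_zero_iff s).mpr hs, map_zero]
    ext x
    obtain ⟨r, rfl⟩ := residue_surjective x
    rw [← ResidueField.algebraMap_eq, Algebra.algebraMap_eq_smul_one, map_smul, h1, smul_zero,
      LinearMap.zero_apply]

lemma DepthGE.eq_zero_of_pow {n : ℕ} (h : DepthGE R n X) (hn : 1 ≤ n) {N : ℕ} {x : X}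
    (hx : ∀ s ∈ maximalIdeal R ^ N, s • x = 0) : x = 0 := by
  have h1 := depthGE_one_iff.mp (h.mono hn)
  induction N with
  | zero => simpa using hx 1 (by simp)
  | succ N ih =>
    refine ih fun s hs => h1 _ fun t ht => ?_
    rw [smul_smul]
    exact hx _ (by rw [pow_succ']; exact Ideal.mul_mem_mul ht hs)

lemma DepthGE.surjective_of_pow_smul_mem_range {f : X →ₗ[R] Y} (hf : Function.Injective f)
    (hX : DepthGE R 2 X) (hY : DepthGE R 1 Y) {N : ℕ}
    (h : ∀ s ∈ maximalIdeal R ^ N, ∀ y, s • y ∈ LinearMap.range f) : Function.Surjective f := by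
  have hC : DepthGE R 1 (Y ⧸ LinearMap.range f) :=
    DepthGE.cokernel hf (LinearMap.exact_map_mkQ_range f) (Submodule.mkQ_surjective _) hX hY
  intro y
  have : (LinearMap.range f).mkQ y = 0 := hC.eq_zero_of_pow le_rfl (N := N) fun s hs => by
    rw [← map_smul]
    exact (Submodule.Quotient.mk_eq_zero _).mpr (h s hs y)
  exact (Submodule.Quotient.mk_eq_zero _).mp this

end Depth

section DualPrecomp

variable {R : Type u} [CommRing R] {Γ : Type u} [Ring Γ]
variable {L : Type u} [AddCommGroup L] [Module Γ L]
variable {Q : Type u} [AddCommGroup Q] [Module Γ Q]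
variable {K : Type u} [AddCommGroup K] [Module Γ K]
variable {Y : Type u} [AddCommGroup Y] [Module Γ Y]

lemma comp_eq_zero_iff_of_exact {f : L →ₗ[Γ] Q} {g : Q →ₗ[Γ] K} (hfg : Function.Exact f g)
    (hg : Function.Surjective g) {φ : Q →ₗ[Γ] Y} :
    φ.comp f = 0 ↔ ∃ ψ : K →ₗ[Γ] Y, ψ.comp g = φ := by
  constructor
  · intro h
    have h0 : LinearMap.ker g ≤ LinearMap.ker φ := fun q hq => by
      obtain ⟨l, rfl⟩ := (hfg q).mp hq
      exact LinearMap.congr_fun h l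
    refine ⟨((LinearMap.ker g).liftQ φ h0).comp (g.quotKerEquivOfSurjective hg).symm.toLinearMap,
      ?_⟩
    ext q
    change (LinearMap.ker g).liftQ φ h0 ((g.quotKerEquivOfSurjective hg).symm (g q)) = φ q
    have : (g.quotKerEquivOfSurjective hg).symm (g q) = Submodule.Quotient.mk q := by
      rw [LinearEquiv.symm_apply_eq]
      rfl
    rw [this, Submodule.liftQ_apply]
  · rintro ⟨ψ, rfl⟩
    ext l
    change ψ (g (f l)) = 0
    rw [hfg.apply_apply_eq_zero, map_zero]

variable [Module R Y] [SMulCommClass Γ R Y]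

variable (R Y) in
/-- Precomposition with a `Γ`-linear map, as an `R`-linear map between duals into `Y`. -/
def dualPrecomp (f : L →ₗ[Γ] Q) : (Q →ₗ[Γ] Y) →ₗ[R] (L →ₗ[Γ] Y) where
  toFun φ := φ.comp f
  map_add' _ _ := rfl
  map_smul' _ _ := rfl

lemma dualPrecomp_injective {g : Q →ₗ[Γ] K} (hg : Function.Surjective g) :
    Function.Injective (dualPrecomp R Y g) := fun _ _ h => (LinearMap.cancel_right hg).mp h

lemma exact_dualPrecomp {f : L →ₗ[Γ] Q} {g : Q →ₗ[Γ] K} (hfg : Function.Exact f g)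
    (hg : Function.Surjective g) : Function.Exact (dualPrecomp R Y g) (dualPrecomp R Y f) :=
  fun _ => comp_eq_zero_iff_of_exact hfg hg

variable [IsLocalRing R]

lemma DepthGE.dual_one (h : DepthGE R 1 Y) : DepthGE R 1 (L →ₗ[Γ] Y) :=
  depthGE_one_iff.mpr fun _ hφ => LinearMap.ext fun l =>
    depthGE_one_iff.mp h _ fun s hs => LinearMap.congr_fun (hφ s hs) l

lemma DepthGE.dual_free {n : ℕ} (h : DepthGE R n Y) (k : ℕ) :
    DepthGE R n ((Fin k → Γ) →ₗ[Γ] Y) := by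
  let e := ((Pi.basisFun Γ (Fin k)).constr R : (Fin k → Y) ≃ₗ[R] ((Fin k → Γ) →ₗ[Γ] Y))
  exact (h.pi (Fin k)).of_leftInverse e.symm.toLinearMap e.toLinearMap (by ext; simp)

end DualPrecomp

section StablyKills

variable (R : Type u) [CommRing R] {Γ : Type u} [Ring Γ] [Algebra R Γ]

/-- The action of a scalar of the base ring on a `Γ`-module, as a `Γ`-linear map. -/
def scalarEnd (Γ : Type u) [Ring Γ] [Algebra R Γ] (s : R) (K : Type u) [AddCommGroup K]
    [Module Γ K] : K →ₗ[Γ] K where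
  toFun k := algebraMap R Γ s • k
  map_add' := smul_add _
  map_smul' a k := by
    rw [RingHom.id_apply, smul_smul, smul_smul, Algebra.commutes]

/-- Multiplication by `s` on `K` factors through a projective `Γ`-module. -/
def StablyKills (Γ : Type u) [Ring Γ] [Algebra R Γ] (s : R) (K : Type u) [AddCommGroup K]
    [Module Γ K] : Prop :=
  FactorsThroughProjective Γ (scalarEnd R Γ s K)

variable {R}
variable {L : Type u} [AddCommGroup L] [Module Γ L]
variable {Q : Type u} [AddCommGroup Q] [Module Γ Q]
variable {K : Type u} [AddCommGroup K] [Module Γ K]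
variable {Y : Type u} [AddCommGroup Y] [Module Γ Y] [Module R Y] [SMulCommClass Γ R Y]

lemma StablyKills.exists_retraction [Module.Projective Γ Q] {f : L →ₗ[Γ] Q} {g : Q →ₗ[Γ] K}
    (hf : Function.Injective f) (hfg : Function.Exact f g) (hg : Function.Surjective g) {s : R}
    (h : StablyKills R Γ s K) : ∃ ρ : Q →ₗ[Γ] L, ρ.comp f = scalarEnd R Γ s L := by
  obtain ⟨P, _, _, _, a, b, hab⟩ := h
  obtain ⟨b', hb'⟩ := Module.projective_lifting_property g b hg
  let t : Q →ₗ[Γ] Q := scalarEnd R Γ s Q - b'.comp (a.comp g)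
  have ht : ∀ q, t q ∈ LinearMap.range f := fun q => (hfg _).mp <| by
    have h1 : g (b' (a (g q))) = algebraMap R Γ s • g q :=
      (LinearMap.congr_fun hb' (a (g q))).trans (LinearMap.congr_fun hab (g q))
    have h2 : t q = algebraMap R Γ s • q - b' (a (g q)) := rfl
    rw [h2, map_sub, map_smul, h1, sub_self]
  refine ⟨(LinearEquiv.ofInjective f hf).symm.toLinearMap.comp (t.codRestrict _ ht), ?_⟩
  ext l
  apply hf
  have h1 : f ((LinearEquiv.ofInjective f hf).symm (t.codRestrict _ ht (f l))) = t (f l) :=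
    congrArg Subtype.val ((LinearEquiv.ofInjective f hf).apply_symm_apply _)
  have h2 : t (f l) = algebraMap R Γ s • f l - b' (a (g (f l))) := rfl
  refine h1.trans ?_
  rw [h2, hfg.apply_apply_eq_zero, map_zero, map_zero, sub_zero, ← map_smul]
  rfl

lemma StablyKills.of_exact [Module.Projective Γ Q] {f : L →ₗ[Γ] Q} {g : Q →ₗ[Γ] K}
    (hf : Function.Injective f) (hfg : Function.Exact f g) (hg : Function.Surjective g) {s : R}
    (h : StablyKills R Γ s K) : StablyKills R Γ s L := by
  obtain ⟨ρ, hρ⟩ := h.exists_retraction hf hfg hg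
  exact ⟨Q, inferInstance, inferInstance, inferInstance, f, ρ, hρ⟩

lemma StablyKills.smul_mem_range_dualPrecomp [IsScalarTower R Γ Y] [Module.Projective Γ Q]
    {f : L →ₗ[Γ] Q}
    {g : Q →ₗ[Γ] K} (hf : Function.Injective f) (hfg : Function.Exact f g)
    (hg : Function.Surjective g) {s : R} (h : StablyKills R Γ s K) (φ : L →ₗ[Γ] Y) :
    s • φ ∈ LinearMap.range (dualPrecomp R Y f) := by
  obtain ⟨ρ, hρ⟩ := h.exists_retraction hf hfg hg
  refine ⟨φ.comp ρ, ?_⟩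
  ext l
  have h1 : ρ (f l) = algebraMap R Γ s • l := LinearMap.congr_fun hρ l
  change φ (ρ (f l)) = s • φ l
  rw [h1, map_smul, algebraMap_smul]

variable [IsLocalRing R]

/-- If `K` is stably killed by a power of the maximal ideal and `Hom(K, Y)` has depth at
least `n`, then the extensions of `K` by `Y` vanish in degrees `1, …, n - 2`. -/
lemma subsingleton_ext_of_depthGE_dual [IsNoetherianRing Γ] [IsScalarTower R Γ Y] {d N : ℕ}
    (hY : DepthGE R d Y) (n : ℕ) (hn : n ≤ d) (K : Type u) [AddCommGroup K] [Module Γ K]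
    [Module.Finite Γ K] (hK : ∀ s ∈ maximalIdeal R ^ N, StablyKills R Γ s K)
    (hdual : DepthGE R n (K →ₗ[Γ] Y)) (i : ℕ) (hi : i + 3 ≤ n) :
    Subsingleton (CategoryTheory.Abelian.Ext (ModuleCat.of Γ K) (ModuleCat.of Γ Y) (i + 1)) := by
  induction n generalizing K i with
  | zero => omega
  | succ n ih =>
    obtain ⟨k, g, hg⟩ := Module.Finite.exists_fin' Γ K
    have hf := (LinearMap.ker g).subtype_injective
    have hfg : Function.Exact (LinearMap.ker g).subtype g := LinearMap.exact_subtype_ker_map g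
    have hB : DepthGE R n (LinearMap.range (dualPrecomp R Y (LinearMap.ker g).subtype)) := by
      refine DepthGE.cokernel (g := (dualPrecomp R Y (LinearMap.ker g).subtype).rangeRestrict)
        (dualPrecomp_injective hg) ?_ (LinearMap.surjective_rangeRestrict _)
        hdual ((hY.mono (by omega)).dual_free k)
      intro φ
      rw [← exact_dualPrecomp hfg hg φ, ← Subtype.coe_inj]
      rfl
    have hsurj : Function.Surjective
        (LinearMap.range (dualPrecomp R Y (LinearMap.ker g).subtype)).subtype := by
      refine DepthGE.surjective_of_pow_smul_mem_range (N := N)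
        (Submodule.subtype_injective _) (hB.mono (by omega)) (hY.mono (by omega)).dual_one ?_
      intro s hs φ
      rw [Submodule.range_subtype]
      exact (hK s hs).smul_mem_range_dualPrecomp hf hfg hg φ
    have hL : DepthGE R n (LinearMap.ker g →ₗ[Γ] Y) := by
      let e := LinearEquiv.ofBijective _ ⟨Submodule.subtype_injective _, hsurj⟩
      exact hB.of_leftInverse e.symm.toLinearMap e.toLinearMap (by ext; simp)
    cases i with
    | zero =>
      refine subsingleton_ext_one_of_extends hf hfg hg fun φ => ?_
      obtain ⟨⟨_, ψ, rfl⟩, rfl⟩ := hsurj φ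
      exact ⟨ψ, rfl⟩
    | succ i =>
      refine subsingleton_ext_succ_of_kernel hf hfg hg (i + 1) ?_
      exact ih (by omega) _ (fun s hs => (hK s hs).of_exact hf hfg hg) hL i (by omega)

end StablyKills

section CokernelSequence

variable {R : Type u} [CommRing R] {Γ : Type u} [Ring Γ] [Algebra R Γ]
variable {D : Type u} [AddCommGroup D] [Module Γ D]
variable {D₀ : Type u} [AddCommGroup D₀] [Module Γ D₀]
variable {D₁ : Type u} [AddCommGroup D₁] [Module Γ D₁]
variable {Y : Type u} [AddCommGroup Y] [Module Γ Y] [Module R Y] [SMulCommClass Γ R Y]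
variable {α : D₀ →ₗ[Γ] D₁} {β : D →ₗ[Γ] D₀}

lemma exact_rangeRestrict (hex : Function.Exact β α) :
    Function.Exact β α.rangeRestrict := fun x => by
  rw [← hex x, ← Subtype.coe_inj]
  rfl

lemma StablyKills.of_cokernel_range [Module.Projective Γ D₁] {s : R}
    (h : StablyKills R Γ s (D₁ ⧸ LinearMap.range α)) :
    StablyKills R Γ s (LinearMap.range α) :=
  h.of_exact (Submodule.injective_subtype _) (LinearMap.exact_subtype_mkQ _)
    (Submodule.mkQ_surjective _)

lemma StablyKills.exists_smul_eq_of_cokernel [Module.Projective Γ D₁]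
    [IsScalarTower R Γ Y] {s : R}
    (h : StablyKills R Γ s (D₁ ⧸ LinearMap.range α)) (φ : LinearMap.range α →ₗ[Γ] Y) :
    ∃ ψ : D₁ →ₗ[Γ] Y, ψ.comp (LinearMap.range α).subtype = s • φ :=
  h.smul_mem_range_dualPrecomp (Submodule.injective_subtype _) (LinearMap.exact_subtype_mkQ _)
    (Submodule.mkQ_surjective _) φ

lemma StablyKills.of_cokernel [Module.Projective Γ D₀] [Module.Projective Γ D₁]
    (hβ : Function.Injective β) (hex : Function.Exact β α) {s : R}
    (h : StablyKills R Γ s (D₁ ⧸ LinearMap.range α)) : StablyKills R Γ s D :=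
  h.of_cokernel_range.of_exact hβ (exact_rangeRestrict hex) α.surjective_rangeRestrict

lemma StablyKills.exists_smul_eq_of_cokernel' [Module.Projective Γ D₀]
    [Module.Projective Γ D₁] [IsScalarTower R Γ Y] (hβ : Function.Injective β)
    (hex : Function.Exact β α) {s : R} (h : StablyKills R Γ s (D₁ ⧸ LinearMap.range α))
    (φ : D →ₗ[Γ] Y) : ∃ ψ : D₀ →ₗ[Γ] Y, ψ.comp β = s • φ :=
  h.of_cokernel_range.smul_mem_range_dualPrecomp hβ (exact_rangeRestrict hex)
    α.surjective_rangeRestrict φ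

lemma subsingleton_ext_cokernel [Module.Projective Γ D₀] [Module.Projective Γ D₁]
    [IsLocalRing R] [IsNoetherianRing Γ] [Module.Finite Γ D]
    [IsScalarTower R Γ Y] {d N : ℕ} (hY : DepthGE R d Y)
    (hβ : Function.Injective β) (hex : Function.Exact β α)
    (hN : ∀ s ∈ maximalIdeal R ^ N, StablyKills R Γ s (D₁ ⧸ LinearMap.range α))
    (h₁ : 1 ≤ d → ∀ φ : LinearMap.range α →ₗ[Γ] Y, ∃ ψ : D₁ →ₗ[Γ] Y,
      ψ.comp (LinearMap.range α).subtype = φ)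
    (h₂ : 2 ≤ d → ∀ φ : D →ₗ[Γ] Y, ∃ ψ : D₀ →ₗ[Γ] Y, ψ.comp β = φ)
    (h₃ : 2 ≤ d → DepthGE R d (D →ₗ[Γ] Y)) (i : ℕ) (hi : i < d) :
    Subsingleton (CategoryTheory.Abelian.Ext (ModuleCat.of Γ (D₁ ⧸ LinearMap.range α))
      (ModuleCat.of Γ Y) (i + 1)) := by
  have hinj := Submodule.injective_subtype (LinearMap.range α)
  have hexQ := LinearMap.exact_subtype_mkQ (LinearMap.range α)
  have hsurj := Submodule.mkQ_surjective (LinearMap.range α)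
  have hex' := exact_rangeRestrict hex
  have hsurj' := α.surjective_rangeRestrict
  match i with
  | 0 => exact subsingleton_ext_one_of_extends hinj hexQ hsurj (h₁ hi)
  | 1 =>
    exact subsingleton_ext_succ_of_kernel hinj hexQ hsurj 1
      (subsingleton_ext_one_of_extends hβ hex' hsurj' (h₂ hi))
  | i + 2 =>
    exact subsingleton_ext_succ_of_kernel hinj hexQ hsurj (i + 2)
      (subsingleton_ext_succ_of_kernel hβ hex' hsurj' (i + 1)
        (subsingleton_ext_of_depthGE_dual hY d le_rfl _
          (fun s hs => (hN s hs).of_cokernel hβ hex) (h₃ (by omega)) i hi))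

end CokernelSequence

section DualBasis

variable {Λ : Type u} [Ring Λ] {P : Type u} [AddCommGroup P] [Module Λ P]

lemma exists_dualBasis [Module.Projective Λ P] [Module.Finite Λ P] :
    ∃ (n : ℕ) (x : Fin n → P) (f : Fin n → P →ₗ[Λ] Λ), ∀ p, ∑ i, f i p • x i = p := by
  obtain ⟨n, g, hg⟩ := Module.Finite.exists_fin' Λ P
  obtain ⟨σ, hσ⟩ := Module.projective_lifting_property g LinearMap.id hg
  refine ⟨n, fun i => g (Pi.single i 1), fun i => (LinearMap.proj i).comp σ, fun p => ?_⟩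
  calc ∑ i, σ p i • g (Pi.single i 1) = g (∑ i, σ p i • Pi.single i 1) := by
        simp only [map_sum, map_smul]
    _ = g (σ p) := by rw [← pi_eq_sum_univ' (σ p)]
    _ = p := LinearMap.congr_fun hσ p

lemma sum_op_smul_eq {n : ℕ} {x : Fin n → P} {f : Fin n → P →ₗ[Λ] Λ}
    (hx : ∀ p, ∑ i, f i p • x i = p) (φ : P →ₗ[Λ] Λ) :
    ∑ i, MulOpposite.op (φ (x i)) • f i = φ := by
  ext p
  conv_rhs => rw [← hx p]
  simp [LinearMap.sum_apply]

variable (Λ P) in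
lemma projective_and_finite_dual [Module.Projective Λ P] [Module.Finite Λ P] :
    Module.Projective Λᵐᵒᵖ (P →ₗ[Λ] Λ) ∧ Module.Finite Λᵐᵒᵖ (P →ₗ[Λ] Λ) := by
  obtain ⟨n, x, f, hx⟩ := exists_dualBasis (Λ := Λ) (P := P)
  let b : (P →ₗ[Λ] Λ) →ₗ[Λᵐᵒᵖ] (Fin n → Λᵐᵒᵖ) :=
    { toFun := fun φ i => MulOpposite.op (φ (x i))
      map_add' := fun _ _ => rfl
      map_smul' := fun _ _ => rfl }
  let a : (Fin n → Λᵐᵒᵖ) →ₗ[Λᵐᵒᵖ] (P →ₗ[Λ] Λ) := Fintype.linearCombination Λᵐᵒᵖ f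
  have hab : a.comp b = LinearMap.id :=
    LinearMap.ext fun φ => (Fintype.linearCombination_apply _ _ _).trans (sum_op_smul_eq hx φ)
  exact ⟨Module.Projective.of_split b a hab,
    Module.Finite.of_surjective a (LinearMap.surjective_of_comp_eq_id b a hab)⟩

/-- Evaluation at `p` on the `Λ`-dual of `P`. -/
def evalDual (p : P) : (P →ₗ[Λ] Λ) →ₗ[Λᵐᵒᵖ] Λ where
  toFun φ := φ p
  map_add' _ _ := rfl
  map_smul' _ _ := rfl

lemma evalDual_surjective [Module.Projective Λ P] [Module.Finite Λ P]
    (Φ : (P →ₗ[Λ] Λ) →ₗ[Λᵐᵒᵖ] Λ) : ∃ p, evalDual p = Φ := by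
  obtain ⟨n, x, f, hx⟩ := exists_dualBasis (Λ := Λ) (P := P)
  refine ⟨∑ i, Φ (f i) • x i, LinearMap.ext fun φ => ?_⟩
  change φ (∑ i, Φ (f i) • x i) = Φ φ
  conv_rhs => rw [← sum_op_smul_eq hx φ]
  simp

lemma eq_of_forall_dual_eq [Module.Projective Λ P] [Module.Finite Λ P] {p q : P}
    (h : ∀ φ : P →ₗ[Λ] Λ, φ p = φ q) : p = q := by
  obtain ⟨n, x, f, hx⟩ := exists_dualBasis (Λ := Λ) (P := P)
  rw [← hx p, ← hx q]
  simp only [h]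

end DualBasis

section Transpose

variable {R : Type u} [CommRing R] {Λ : Type u} [Ring Λ] [Algebra R Λ]
variable {M : Type u} [AddCommGroup M] [Module Λ M]
variable {P₀ : Type u} [AddCommGroup P₀] [Module Λ P₀]
variable {P₁ : Type u} [AddCommGroup P₁] [Module Λ P₁]
variable {π₀ : P₀ →ₗ[Λ] M} {δ : P₁ →ₗ[Λ] P₀}

lemma exists_pow_smulLiftsAlong [IsNoetherianRing R] [IsLocalRing R]
    (hM : ∀ p : Ideal R, p.IsPrime → p ≠ maximalIdeal R → LocallyProjectiveAt R Λ p M)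
    (hπ₀ : Function.Surjective π₀) :
    ∃ N : ℕ, ∀ s ∈ maximalIdeal R ^ N, SmulLiftsAlong R Λ s π₀ := by
  let J : Ideal R :=
    { carrier := {s | SmulLiftsAlong R Λ s π₀}
      add_mem' := by
        rintro s t ⟨g, hg⟩ ⟨h, hh⟩
        exact ⟨g + h, fun m => by
          rw [LinearMap.add_apply, map_add, hg, hh, map_add, add_smul]⟩
      zero_mem' := ⟨0, fun m => by simp⟩
      smul_mem' := by
        rintro r s ⟨h, hh⟩
        refine ⟨h.comp (scalarEnd R Λ r M), fun m => ?_⟩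
        have h1 : (h.comp (scalarEnd R Λ r M)) m = h (algebraMap R Λ r • m) := rfl
        rw [h1, hh, smul_smul, ← map_mul, mul_comm, smul_eq_mul] }
  have hJ : maximalIdeal R ≤ J.radical := by
    rw [Ideal.radical_eq_sInf]
    refine le_sInf ?_
    rintro p ⟨hJp, hp⟩
    by_contra hne
    obtain ⟨s, hs, hsJ⟩ := hM p hp (fun h => hne h.ge) P₀ _ _ π₀ hπ₀
    exact hs (hJp hsJ)
  obtain ⟨N, hN⟩ := Ideal.exists_pow_le_of_le_radical_of_fg hJ
    (IsNoetherian.noetherian (maximalIdeal R))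
  exact ⟨N, fun s hs => hN hs⟩

lemma SmulLiftsAlong.stablyKills_transpose [Module.Projective Λ P₀]
    [Module.Projective Λᵐᵒᵖ (P₁ →ₗ[Λ] Λ)] (hδ : LinearMap.range δ = LinearMap.ker π₀)
    {s : R} (h : SmulLiftsAlong R Λ s π₀) :
    StablyKills R Λᵐᵒᵖ s ((P₁ →ₗ[Λ] Λ) ⧸ LinearMap.range (transposeDual Λ δ)) := by
  obtain ⟨h, hh⟩ := h
  let t : P₀ →ₗ[Λ] P₀ := scalarEnd R Λ s P₀ - h.comp π₀
  have ht : ∀ p, t p ∈ LinearMap.range δ := fun p => by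
    have h1 : t p = algebraMap R Λ s • p - h (π₀ p) := rfl
    rw [hδ, LinearMap.mem_ker, h1, map_sub, hh, map_smul, sub_self]
  obtain ⟨u, hu⟩ := Module.projective_lifting_property δ.rangeRestrict (t.codRestrict _ ht)
    δ.surjective_rangeRestrict
  have hu' : ∀ q, δ (u (δ q)) = algebraMap R Λ s • δ q := fun q => by
    have h1 : δ (u (δ q)) = t (δ q) := congrArg Subtype.val (LinearMap.congr_fun hu (δ q))
    have h2 : t (δ q) = algebraMap R Λ s • δ q - h (π₀ (δ q)) := rfl
    have h3 : π₀ (δ q) = 0 := by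
      rw [← LinearMap.mem_ker, ← hδ]
      exact ⟨q, rfl⟩
    rw [h1, h2, h3, map_zero, sub_zero]
  let a : (P₁ →ₗ[Λ] Λ) →ₗ[Λᵐᵒᵖ] (P₁ →ₗ[Λ] Λ) :=
    scalarEnd R Λᵐᵒᵖ s (P₁ →ₗ[Λ] Λ) - (transposeDual Λ δ).comp (transposeDual Λ u)
  have ha : LinearMap.range (transposeDual Λ δ) ≤ LinearMap.ker a := by
    rintro _ ⟨φ, rfl⟩
    ext q
    change φ (δ q) * algebraMap R Λ s - φ (δ (u (δ q))) = 0
    rw [hu', map_smul, smul_eq_mul, Algebra.commutes, sub_self]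
  refine ⟨P₁ →ₗ[Λ] Λ, inferInstance, inferInstance, inferInstance,
    (LinearMap.range (transposeDual Λ δ)).liftQ a ha,
    (LinearMap.range (transposeDual Λ δ)).mkQ, ?_⟩
  ext φ
  have h0 : (LinearMap.range (transposeDual Λ δ)).mkQ
      (transposeDual Λ δ (transposeDual Λ u φ)) = 0 := by
    rw [← LinearMap.mem_ker, Submodule.ker_mkQ]
    exact ⟨_, rfl⟩
  change (LinearMap.range (transposeDual Λ δ)).mkQ
    (algebraMap R Λᵐᵒᵖ s • φ - transposeDual Λ δ (transposeDual Λ u φ)) = _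
  rw [map_sub, h0, sub_zero]
  rfl

lemma transposeDual_injective (hπ₀ : Function.Surjective π₀) :
    Function.Injective (transposeDual Λ π₀) := fun _ _ h => (LinearMap.cancel_right hπ₀).mp h

lemma exact_transposeDual (hπ₀ : Function.Surjective π₀)
    (hδ : LinearMap.range δ = LinearMap.ker π₀) :
    Function.Exact (transposeDual Λ π₀) (transposeDual Λ δ) :=
  fun _ => comp_eq_zero_iff_of_exact (LinearMap.exact_iff.mpr hδ.symm) hπ₀

end Transpose

section TransposeExt

open CategoryTheory Abelian

variable {R : Type u} [CommRing R] [IsLocalRing R] {Λ : Type u} [Ring Λ] [Algebra R Λ]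
variable {M : Type u} [AddCommGroup M] [Module Λ M] [Module R M] [IsScalarTower R Λ M]
variable {P₀ : Type u} [AddCommGroup P₀] [Module Λ P₀] [Module.Projective Λ P₀]
  [Module.Finite Λ P₀]
variable {P₁ : Type u} [AddCommGroup P₁] [Module Λ P₁] [Module.Projective Λ P₁]
  [Module.Finite Λ P₁]
variable {π₀ : P₀ →ₗ[Λ] M} {δ : P₁ →ₗ[Λ] P₀}

/-- A functional on the image of `Hom_Λ(P₀, Λ) → Hom_Λ(P₁, Λ)` is an evaluation. -/
lemma exists_evalDual_range (hM : DepthGE R 1 M) (hδ : LinearMap.range δ = LinearMap.ker π₀)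
    {N : ℕ} (hN : ∀ s ∈ maximalIdeal R ^ N, SmulLiftsAlong R Λ s π₀)
    (φ : LinearMap.range (transposeDual Λ δ) →ₗ[Λᵐᵒᵖ] Λ) :
    ∃ q : P₁, (evalDual q).comp (LinearMap.range (transposeDual Λ δ)).subtype = φ := by
  have := (projective_and_finite_dual Λ P₁).1
  obtain ⟨p, hp⟩ := evalDual_surjective (φ.comp (transposeDual Λ δ).rangeRestrict)
  have hp' : ∀ f : P₀ →ₗ[Λ] Λ, f p = φ ((transposeDual Λ δ).rangeRestrict f) :=
    LinearMap.congr_fun hp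
  have h0 : π₀ p = 0 := hM.eq_zero_of_pow le_rfl (N := N) fun s hs => by
    obtain ⟨ψ, hψ⟩ := ((hN s hs).stablyKills_transpose hδ).exists_smul_eq_of_cokernel φ
    obtain ⟨q, rfl⟩ := evalDual_surjective ψ
    have h1 : δ q = algebraMap R Λ s • p := eq_of_forall_dual_eq fun f => by
      have h2 : f (δ q) = s • φ ((transposeDual Λ δ).rangeRestrict f) :=
        LinearMap.congr_fun hψ ((transposeDual Λ δ).rangeRestrict f)
      rw [h2, ← hp' f, map_smul, algebraMap_smul]
    rw [← algebraMap_smul Λ s, ← map_smul, ← h1, ← LinearMap.mem_ker, ← hδ]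
    exact ⟨q, rfl⟩
  rw [← LinearMap.mem_ker, ← hδ] at h0
  obtain ⟨q, rfl⟩ := h0
  refine ⟨q, ?_⟩
  rw [← LinearMap.cancel_right (transposeDual Λ δ).surjective_rangeRestrict]
  exact hp

variable (R Λ M) in
/-- The biduality map `M → Hom_{Λᵒᵖ}(Hom_Λ(M, Λ), Λ)`, as an `R`-linear map. -/
def biduality : M →ₗ[R] ((M →ₗ[Λ] Λ) →ₗ[Λᵐᵒᵖ] Λ) where
  toFun := evalDual
  map_add' m m' := LinearMap.ext fun φ => map_add φ m m'
  map_smul' r m := LinearMap.ext fun φ => by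
    change φ (r • m) = r • φ m
    rw [← algebraMap_smul Λ r m, map_smul, algebraMap_smul]

lemma biduality_injective (hM : DepthGE R 1 M) (hπ₀ : Function.Surjective π₀)
    (hδ : LinearMap.range δ = LinearMap.ker π₀)
    {N : ℕ} (hN : ∀ s ∈ maximalIdeal R ^ N, SmulLiftsAlong R Λ s π₀) :
    Function.Injective (biduality R Λ M) := by
  rw [injective_iff_map_eq_zero]
  intro m hm
  obtain ⟨p, rfl⟩ := hπ₀ m
  have h0 : (evalDual p).comp (transposeDual Λ π₀) = 0 :=
    LinearMap.ext fun f => LinearMap.congr_fun hm f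
  obtain ⟨φ, hφ⟩ := (comp_eq_zero_iff_of_exact
    (exact_rangeRestrict (exact_transposeDual hπ₀ hδ))
    (transposeDual Λ δ).surjective_rangeRestrict).mp h0
  obtain ⟨q, rfl⟩ := exists_evalDual_range hM hδ hN φ
  have h1 : δ q = p := eq_of_forall_dual_eq fun f => LinearMap.congr_fun hφ f
  rw [← h1, ← LinearMap.mem_ker, ← hδ]
  exact ⟨q, rfl⟩

lemma biduality_surjective (hM : DepthGE R 2 M) (hΛ : DepthGE R 1 Λ)
    (hπ₀ : Function.Surjective π₀) (hδ : LinearMap.range δ = LinearMap.ker π₀)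
    {N : ℕ} (hN : ∀ s ∈ maximalIdeal R ^ N, SmulLiftsAlong R Λ s π₀) :
    Function.Surjective (biduality R Λ M) := by
  have := (projective_and_finite_dual Λ P₀).1
  have := (projective_and_finite_dual Λ P₁).1
  refine DepthGE.surjective_of_pow_smul_mem_range (N := N)
    (biduality_injective (hM.mono one_le_two) hπ₀ hδ hN) hM hΛ.dual_one fun s hs φ => ?_
  obtain ⟨ψ, hψ⟩ := ((hN s hs).stablyKills_transpose hδ).exists_smul_eq_of_cokernel'
    (transposeDual_injective hπ₀) (exact_transposeDual hπ₀ hδ) φ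
  obtain ⟨p, rfl⟩ := evalDual_surjective ψ
  exact ⟨π₀ p, hψ⟩

lemma subsingleton_ext_transpose [IsNoetherianRing Λᵐᵒᵖ] {d : ℕ} (hM : DepthGE R d M)
    (hΛ : DepthGE R d Λ) (hπ₀ : Function.Surjective π₀)
    (hδ : LinearMap.range δ = LinearMap.ker π₀)
    {N : ℕ} (hN : ∀ s ∈ maximalIdeal R ^ N, SmulLiftsAlong R Λ s π₀) (i : ℕ) (hi : i < d) :
    Subsingleton (Ext
      (ModuleCat.of Λᵐᵒᵖ ((P₁ →ₗ[Λ] Λ) ⧸ LinearMap.range (transposeDual Λ δ)))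
      (ModuleCat.of Λᵐᵒᵖ Λ) (i + 1)) := by
  obtain ⟨_, _⟩ := projective_and_finite_dual Λ P₀
  have := (projective_and_finite_dual Λ P₁).1
  have hinj := transposeDual_injective (Λ := Λ) hπ₀
  have hfin : Module.Finite Λᵐᵒᵖ (M →ₗ[Λ] Λ) := Module.Finite.of_injective _ hinj
  refine subsingleton_ext_cokernel hΛ hinj (exact_transposeDual hπ₀ hδ)
    (fun s hs => (hN s hs).stablyKills_transpose hδ) (fun hd φ => ?_) (fun hd φ => ?_)
    (fun hd => ?_) i hi
  · obtain ⟨q, hq⟩ := exists_evalDual_range (hM.mono hd) hδ hN φ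
    exact ⟨evalDual q, hq⟩
  · obtain ⟨m, rfl⟩ := biduality_surjective (hM.mono hd) (hΛ.mono (by omega)) hπ₀ hδ hN φ
    obtain ⟨p, rfl⟩ := hπ₀ m
    exact ⟨evalDual p, rfl⟩
  · let e := LinearEquiv.ofBijective (biduality R Λ M)
      ⟨biduality_injective (hM.mono (by omega)) hπ₀ hδ hN,
        biduality_surjective (hM.mono hd) (hΛ.mono (by omega)) hπ₀ hδ hN⟩
    exact hM.of_leftInverse e.symm.toLinearMap e.toLinearMap (by ext; simp)

end TransposeExt

/-- Suppose `dim R = d ≥ 1` and let `M` be a `Λ`-lattice with minimal projective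
presentation `P₁ --δ--> P₀ --π₀--> M → 0` and transpose
`Tr M = coker (Hom_Λ(P₀, Λ) → Hom_Λ(P₁, Λ))`, a `Λᵒᵖ`-module.  Then
`Ext^i_{Λᵒᵖ}(Tr M, Λ) = 0` for all `1 ≤ i ≤ d`; here the vanishing of the
`i`-th Ext is expressed, by dimension shifting, as the vanishing of
`Ext¹_{Λᵒᵖ}(K, Λ)` for every `(i-1)`-st syzygy module `K` of `Tr M`. -/
theorem ext_of_transpose_vanishes
    (R : Type u) [CommRing R] [IsNoetherianRing R] [IsLocalRing R]
    [IsAdicComplete (maximalIdeal R) R]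
    (d : ℕ) (hdim : ringKrullDim R = (d : WithBot ℕ∞))
    (hCM : IsMCM R R)
    (ω : Type u) [AddCommGroup ω] [Module R ω] (hω : IsCanonicalModule R ω)
    (Λ : Type u) [Ring Λ] [Algebra R Λ] [Module.Finite R Λ]
    (hord : IsLattice R Λ ω Λ)
    (hd : 1 ≤ d)
    (M : Type u) [AddCommGroup M] [Module Λ M] [Module R M] [IsScalarTower R Λ M]
    (hlat : IsLattice R Λ ω M)
    (P₀ : Type u) [AddCommGroup P₀] [Module Λ P₀]
    (P₁ : Type u) [AddCommGroup P₁] [Module Λ P₁]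
    (hP₀proj : Module.Projective Λ P₀) (hP₀fin : Module.Finite Λ P₀)
    (hP₁proj : Module.Projective Λ P₁) (hP₁fin : Module.Finite Λ P₁)
    (π₀ : P₀ →ₗ[Λ] M) (hπ₀ : Function.Surjective π₀)
    (hmin₀ : ∀ N : Submodule Λ P₀, N ⊔ LinearMap.ker π₀ = ⊤ → N = ⊤)
    (δ : P₁ →ₗ[Λ] P₀) (hδ : LinearMap.range δ = LinearMap.ker π₀)
    (hmin₁ : ∀ N : Submodule Λ P₁, N ⊔ LinearMap.ker δ = ⊤ → N = ⊤) :
    ∀ i : ℕ, 1 ≤ i → i ≤ d →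
      ∀ (K : Type u) (_ : AddCommGroup K) (_ : Module Λᵐᵒᵖ K),
        IsSyzygyOf Λᵐᵒᵖ (i - 1) K
          ((P₁ →ₗ[Λ] Λ) ⧸ LinearMap.range (transposeDual Λ δ)) →
          Ext1Vanishes Λᵐᵒᵖ K Λ := by
  intro i hi₁ hi K _ _ hK
  have : Module.Finite Λ M := hlat.1
  have : Module.Finite R M := Module.Finite.trans Λ M
  have : Module.Finite R Λᵐᵒᵖ := Module.Finite.equiv (MulOpposite.opLinearEquiv R)
  have : IsNoetherianRing Λᵐᵒᵖ := IsNoetherianRing.of_finite R Λᵐᵒᵖ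
  have hM : DepthGE R d M := hlat.2.1.depthGE hdim
  have hΛ : DepthGE R d Λ := hord.2.1.depthGE hdim
  obtain ⟨N, hN⟩ := exists_pow_smulLiftsAlong hlat.2.2.1 hπ₀
  have hT := subsingleton_ext_transpose hM hΛ hπ₀ hδ hN (i - 1) (by omega)
  exact ext1Vanishes_of_subsingleton_ext (subsingleton_ext_of_isSyzygyOf hK 0 hT)

end BT
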